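/- arXiv:2507.08503 — 3 statements merged into one kernel-verified Lean document; each statement's English description precedes it below -/
import Mathlib

section
/- For every integer n ≥ 4, the Staller-start game isolation number of the cycle C_n satisfies: ι_g'(C_n) = 2·⌊n/5⌋ + 1 if n ≡ 4 (mod 5), and ι_g'(C_n) = 2·⌊n/5⌋ otherwise. -/
open SimpleGraph

variable {V : Type*}

/-- The closed neighborhood `N_G[X]` of a set `X` of vertices: all vertices that are in `X`
or adjacent to a vertex of `X`. -/
def closedNbhdSet (G : SimpleGraph V) (X : Set V) : Set V :=
  {u | u ∈ X ∨ ∃ x ∈ X, G.Adj x u}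

/-- A vertex `v` is playable with respect to the set `X` of already selected vertices if the
closed neighborhood of `v` contains a vertex `u ∉ N_G[X]` having a neighbor `w ∉ N_G[X]`,
i.e. `v` dominates a vertex of a nontrivial component of `G - N_G[X]`. -/
def IsPlayable (G : SimpleGraph V) (X : Set V) (v : V) : Prop :=
  ∃ u, (u = v ∨ G.Adj v u) ∧ u ∉ closedNbhdSet G X ∧
    ∃ w, G.Adj u w ∧ w ∉ closedNbhdSet G X

open Classical in
/-- The optimal-play value (number of further selected vertices) of the isolation game
position with given fuel, player to move (`true` = Dominator, the minimizer;
`false` = Staller, the maximizer) and set `X` of already selected vertices. -/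
noncomputable def isoGameVal (G : SimpleGraph V) : ℕ → Bool → Set V → ℕ
  | 0, _, _ => 0
  | (k + 1), isDom, X =>
    if ∃ v, IsPlayable G X v then
      (if isDom then sInf else sSup)
        {n : ℕ | ∃ v, IsPlayable G X v ∧ n = isoGameVal G k (!isDom) (insert v X) + 1}
    else 0

/-- The game isolation number `ι_g(G)`: the number of vertices selected in the isolation
game on `G` when Dominator moves first and both players play optimally.  (A game on a
graph with `n` vertices lasts at most `n` moves, so fuel `Fintype.card V` suffices.) -/
noncomputable def iotaGame (G : SimpleGraph V) [Fintype V] : ℕ :=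
  isoGameVal G (Fintype.card V) true ∅

/-- The Staller-start game isolation number `ι_g'(G)`: the number of vertices selected in
the isolation game on `G` when Staller moves first and both players play optimally. -/
noncomputable def iotaGame' (G : SimpleGraph V) [Fintype V] : ℕ :=
  isoGameVal G (Fintype.card V) false ∅

/-- The weight, in eighths of a move, of a run of `l` consecutive undominated vertices. -/
def runWeight (l : ℕ) : ℕ :=
  16 * ((l - 1) / 5) +
    if (l - 1) % 5 = 0 then 0 else if (l - 1) % 5 = 1 then 8 else
    if (l - 1) % 5 = 2 then 12 else if (l - 1) % 5 = 3 then 14 else 15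

lemma runWeight_of_lt_two {l : ℕ} (h : l < 2) : runWeight l = 0 := by
  unfold runWeight; split_ifs <;> omega

lemma runWeight_mod_eight (l : ℕ) :
    runWeight l % 8 = 0 ∨ runWeight l % 8 = 4 ∨ runWeight l % 8 = 6 ∨ runWeight l % 8 = 7 := by
  unfold runWeight; split_ifs <;> omega

lemma runWeight_pred_bounds {l : ℕ} (h : 2 ≤ l) :
    runWeight (l - 1) + 1 ≤ runWeight l ∧ runWeight l ≤ runWeight (l - 1) + 15 := by
  unfold runWeight; split_ifs <;> omega

lemma runWeight_sub_two_bounds {l : ℕ} (h : 2 ≤ l) :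
    runWeight (l - 2) + 1 ≤ runWeight l ∧ runWeight l ≤ runWeight (l - 2) + 15 := by
  unfold runWeight; split_ifs <;> omega

lemma runWeight_add_five_mul {l : ℕ} (q : ℕ) (h : 1 ≤ l) :
    runWeight (l + 5 * q) = runWeight l + 16 * q := by
  unfold runWeight
  rw [show l + 5 * q - 1 = l - 1 + 5 * q by omega, Nat.add_mul_mod_self_left,
    Nat.add_mul_div_left _ _ (by norm_num)]
  ring

lemma exists_runWeight_eq_add (l : ℕ) :
    ∃ i q, i ≤ 5 ∧ l = i + 5 * q ∧ runWeight l = runWeight i + 16 * q := by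
  by_cases h : l = 0
  · exact ⟨0, 0, by simp [h]⟩
  · have hl : l = (l - 1) % 5 + 1 + 5 * ((l - 1) / 5) := by omega
    refine ⟨(l - 1) % 5 + 1, (l - 1) / 5, by omega, hl, ?_⟩
    rw [← runWeight_add_five_mul _ (by omega), ← hl]

lemma runWeight_split_bounds (a b : ℕ) :
    runWeight a + runWeight b + 1 ≤ runWeight (a + b + 3) ∧
      runWeight (a + b + 3) ≤ runWeight a + runWeight b + 15 := by
  obtain ⟨i, q, hi, rfl, hiq⟩ := exists_runWeight_eq_add a
  obtain ⟨j, r, hj, rfl, hjr⟩ := exists_runWeight_eq_add b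
  rw [hiq, hjr, show i + 5 * q + (j + 5 * r) + 3 = i + j + 3 + 5 * (q + r) by ring,
    runWeight_add_five_mul (q + r) (by omega)]
  have base : ∀ i ≤ 5, ∀ j ≤ 5, runWeight i + runWeight j + 1 ≤ runWeight (i + j + 3) ∧
      runWeight (i + j + 3) ≤ runWeight i + runWeight j + 15 := by decide
  have := base i hi j hj
  omega

lemma runWeight_le_pred {l : ℕ} (h : 2 ≤ l) :
    runWeight l + runWeight l % 8 ≤ runWeight (l - 1) + 8 := by
  unfold runWeight; split_ifs <;> omega

lemma runWeight_sub_four_le {l : ℕ} (h : 4 ≤ l) :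
    runWeight (l - 4) + 8 + runWeight l % 8 ≤ runWeight l := by
  unfold runWeight; split_ifs <;> omega

/-- The total weight of a list of runs, each given by its first position and its length. -/
def runListWeight (L : List (ℕ × ℕ)) : ℕ := (L.map fun p => runWeight p.2).sum

/-- The total length of a list of runs. -/
def runListLength (L : List (ℕ × ℕ)) : ℕ := (L.map Prod.snd).sum

@[simp] lemma runListWeight_nil : runListWeight [] = 0 := rfl
@[simp] lemma runListLength_nil : runListLength [] = 0 := rfl

@[simp] lemma runListWeight_cons (p : ℕ × ℕ) (L : List (ℕ × ℕ)) :
    runListWeight (p :: L) = runWeight p.2 + runListWeight L := by simp [runListWeight]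

@[simp] lemma runListLength_cons (p : ℕ × ℕ) (L : List (ℕ × ℕ)) :
    runListLength (p :: L) = p.2 + runListLength L := by simp [runListLength]

@[simp] lemma runListWeight_append (L M : List (ℕ × ℕ)) :
    runListWeight (L ++ M) = runListWeight L + runListWeight M := by simp [runListWeight]

@[simp] lemma runListLength_append (L M : List (ℕ × ℕ)) :
    runListLength (L ++ M) = runListLength L + runListLength M := by simp [runListLength]

lemma runListWeight_perm {L M : List (ℕ × ℕ)} (h : L.Perm M) :
    runListWeight L = runListWeight M := (h.map _).sum_eq

lemma runListLength_perm {L M : List (ℕ × ℕ)} (h : L.Perm M) :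
    runListLength L = runListLength M := (h.map _).sum_eq

lemma exists_not_dvd_runWeight {d : ℕ} {L : List (ℕ × ℕ)} (h : ¬ d ∣ runListWeight L) :
    ∃ p ∈ L, ¬ d ∣ runWeight p.2 := by
  by_contra! hL
  refine h (List.dvd_sum fun x hx => ?_)
  obtain ⟨p, hp, rfl⟩ := List.mem_map.1 hx
  exact hL p hp

lemma two_le_of_not_dvd_runWeight {d l : ℕ} (h : ¬ d ∣ runWeight l) : 2 ≤ l := by
  by_contra! hl
  exact h (runWeight_of_lt_two hl ▸ dvd_zero d)

lemma exists_two_le_of_runListWeight_ne_zero {L : List (ℕ × ℕ)} (h : runListWeight L ≠ 0) :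
    ∃ p ∈ L, 2 ≤ p.2 := by
  obtain ⟨p, hp, hd⟩ := exists_not_dvd_runWeight (d := 0) (by simpa using h)
  exact ⟨p, hp, two_le_of_not_dvd_runWeight hd⟩

/-- The run Dominator attacks: its weight modulo `8` is at least that of the whole position. -/
lemma exists_mod_le_runWeight_mod {L : List (ℕ × ℕ)} (h : ∃ p ∈ L, 2 ≤ p.2) :
    ∃ p ∈ L, 2 ≤ p.2 ∧ runListWeight L % 8 ≤ runWeight p.2 % 8 := by
  by_cases h2 : 2 ∣ runListWeight L
  · by_cases h4 : 4 ∣ runListWeight L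
    · by_cases h8 : 8 ∣ runListWeight L
      · obtain ⟨p, hp, hl⟩ := h
        exact ⟨p, hp, hl, by omega⟩
      · obtain ⟨p, hp, hd⟩ := exists_not_dvd_runWeight h8
        refine ⟨p, hp, two_le_of_not_dvd_runWeight hd, ?_⟩
        have := runWeight_mod_eight p.2
        omega
    · obtain ⟨p, hp, hd⟩ := exists_not_dvd_runWeight h4
      refine ⟨p, hp, two_le_of_not_dvd_runWeight hd, ?_⟩
      have := runWeight_mod_eight p.2
      omega
  · obtain ⟨p, hp, hd⟩ := exists_not_dvd_runWeight h2
    refine ⟨p, hp, two_le_of_not_dvd_runWeight hd, ?_⟩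
    have := runWeight_mod_eight p.2
    omega

/-- The run Staller shortens. -/
lemma exists_eight_le_mod_add_mod {L : List (ℕ × ℕ)} (h : ∃ p ∈ L, 2 ≤ p.2) :
    ∃ p ∈ L, 2 ≤ p.2 ∧
      (runListWeight L % 8 = 0 ∨ 8 ≤ runListWeight L % 8 + runWeight p.2 % 8) := by
  by_cases h2 : 2 ∣ runListWeight L
  · by_cases h4 : 4 ∣ runListWeight L
    · by_cases h8 : 8 ∣ runListWeight L
      · obtain ⟨p, hp, hl⟩ := h
        exact ⟨p, hp, hl, by omega⟩
      · obtain ⟨p, hp, hd⟩ := exists_not_dvd_runWeight h8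
        refine ⟨p, hp, two_le_of_not_dvd_runWeight hd, ?_⟩
        have := runWeight_mod_eight p.2
        omega
    · obtain ⟨p, hp, hd⟩ := exists_not_dvd_runWeight h4
      refine ⟨p, hp, two_le_of_not_dvd_runWeight hd, ?_⟩
      have := runWeight_mod_eight p.2
      omega
  · obtain ⟨p, hp, hd⟩ := exists_not_dvd_runWeight h2
    refine ⟨p, hp, two_le_of_not_dvd_runWeight hd, ?_⟩
    have := runWeight_mod_eight p.2
    omega

/-- Two runs are separated by at least two positions. -/
def RunsSeparated (p q : ℕ × ℕ) : Prop := p.1 + p.2 + 2 ≤ q.1 ∨ q.1 + q.2 + 2 ≤ p.1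

lemma RunsSeparated.symm {p q : ℕ × ℕ} (h : RunsSeparated p q) : RunsSeparated q p := Or.symm h

/-- The bijection `c` numbers the vertices of `G` by `0, …, n - 1` along a cycle. -/
structure IsCycleNumbering (G : SimpleGraph V) (n : ℕ) (c : V → ℕ) : Prop where
  lt : ∀ v, c v < n
  inj : ∀ u v, c u = c v → u = v
  surj : ∀ i < n, ∃ v, c v = i
  adj_iff : ∀ u v, G.Adj u v ↔ c u + 1 = c v ∨ c v + 1 = c u ∨
    (c u = 0 ∧ c v + 1 = n) ∨ (c v = 0 ∧ c u + 1 = n)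

/-- `L` lists the runs of vertices not dominated by `X`, where positions `0`, `1` and `n - 1`
are dominated. -/
structure IsRunList (G : SimpleGraph V) (n : ℕ) (c : V → ℕ) (X : Set V)
    (L : List (ℕ × ℕ)) : Prop where
  bounds : ∀ p ∈ L, 2 ≤ p.1 ∧ p.1 + p.2 + 1 ≤ n
  pairwise : L.Pairwise RunsSeparated
  notMem_iff : ∀ v, v ∉ closedNbhdSet G X ↔ ∃ p ∈ L, p.1 ≤ c v ∧ c v < p.1 + p.2

lemma notMem_closedNbhdSet_insert (G : SimpleGraph V) (X : Set V) (u v : V) :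
    u ∉ closedNbhdSet G (insert v X) ↔ u ∉ closedNbhdSet G X ∧ u ≠ v ∧ ¬ G.Adj v u := by
  simp only [closedNbhdSet, Set.mem_ofPred_eq, Set.mem_insert_iff, exists_eq_or_imp, ne_eq]
  grind

variable {G : SimpleGraph V} {n : ℕ} {c : V → ℕ} {X : Set V} {L : List (ℕ × ℕ)}

instance : Std.Symm RunsSeparated := ⟨fun _ _ => RunsSeparated.symm⟩

lemma IsRunList.perm {M : List (ℕ × ℕ)} (h : IsRunList G n c X L) (hLM : L.Perm M) :
    IsRunList G n c X M where
  bounds p hp := h.bounds p (hLM.mem_iff.2 hp)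
  pairwise := (hLM.pairwise_iff RunsSeparated.symm).1 h.pairwise
  notMem_iff v := by simp only [h.notMem_iff v, hLM.mem_iff]

lemma IsRunList.exists_cons {p : ℕ × ℕ} (h : IsRunList G n c X L) (hp : p ∈ L) :
    ∃ M, L.Perm (p :: M) ∧ IsRunList G n c X (p :: M) := by
  classical
  exact ⟨L.erase p, List.perm_cons_erase hp, h.perm (List.perm_cons_erase hp)⟩

lemma IsRunList.isPlayable_iff (h : IsRunList G n c X L) (hc : IsCycleNumbering G n c) (v : V) :
    IsPlayable G X v ↔ ∃ p ∈ L, 2 ≤ p.2 ∧ p.1 ≤ c v + 1 ∧ c v ≤ p.1 + p.2 := by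
  constructor
  · rintro ⟨u, huv, hu, w, huw, hw⟩
    obtain ⟨p, hp, hpu⟩ := (h.notMem_iff u).1 hu
    obtain ⟨q, hq, hqw⟩ := (h.notMem_iff w).1 hw
    have hpb := h.bounds p hp
    have hqb := h.bounds q hq
    have hnear : c u + 1 = c w ∨ c w + 1 = c u := by
      have := (hc.adj_iff u w).1 huw
      omega
    have hpq : p = q := by
      by_contra hne
      have := h.pairwise.forall hp hq hne
      unfold RunsSeparated at this
      omega
    subst hpq
    refine ⟨p, hp, by omega, ?_⟩
    rcases huv with rfl | huv
    · omega
    · have := (hc.adj_iff v u).1 huv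
      omega
  · rintro ⟨p, hp, hl, hpv⟩
    have hpb := h.bounds p hp
    obtain ⟨i, j, hi, hj, hij, hiv⟩ : ∃ i j, (p.1 ≤ i ∧ i < p.1 + p.2) ∧
        (p.1 ≤ j ∧ j < p.1 + p.2) ∧ (i + 1 = j ∨ j + 1 = i) ∧
        (i = c v ∨ c v + 1 = i ∨ i + 1 = c v) := by
      by_cases h1 : p.1 + p.2 ≤ c v + 1
      · exact ⟨p.1 + p.2 - 1, p.1 + p.2 - 2, by omega⟩
      · by_cases h2 : p.1 ≤ c v
        · exact ⟨c v, c v + 1, by omega⟩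
        · exact ⟨p.1, p.1 + 1, by omega⟩
    obtain ⟨u, rfl⟩ := hc.surj i (by omega)
    obtain ⟨w, rfl⟩ := hc.surj j (by omega)
    refine ⟨u, ?_, (h.notMem_iff u).2 ⟨p, hp, hi⟩, w, (hc.adj_iff u w).2 (by omega),
      (h.notMem_iff w).2 ⟨p, hp, hj⟩⟩
    rcases hiv with hiv | hiv
    · exact Or.inl (hc.inj u v hiv)
    · exact Or.inr ((hc.adj_iff v u).2 (by omega))

/-- Selecting a vertex in or next to the run `p` replaces `p` by the runs of `N`. -/
lemma IsRunList.select {p : ℕ × ℕ} {N : List (ℕ × ℕ)} {v : V}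
    (h : IsRunList G n c X (p :: L)) (hc : IsCycleNumbering G n c)
    (hv : p.1 ≤ c v + 1 ∧ c v ≤ p.1 + p.2) (hsep : N.Pairwise RunsSeparated)
    (hsub : ∀ q ∈ N, p.1 ≤ q.1 ∧ q.1 + q.2 ≤ p.1 + p.2)
    (hmem : ∀ j, (∃ q ∈ N, q.1 ≤ j ∧ j < q.1 + q.2) ↔
      (p.1 ≤ j ∧ j < p.1 + p.2) ∧ (j + 1 < c v ∨ c v + 1 < j)) :
    IsRunList G n c (insert v X) (N ++ L) where
  bounds q hq := by
    have hp := h.bounds p (by simp)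
    rcases List.mem_append.1 hq with hq | hq
    · have := hsub q hq
      omega
    · exact h.bounds q (by simp [hq])
  pairwise := by
    obtain ⟨hpL, hL⟩ := List.pairwise_cons.1 h.pairwise
    refine List.pairwise_append.2 ⟨hsep, hL, fun q hq r hr => ?_⟩
    have h1 := hsub q hq
    have h2 := hpL r hr
    unfold RunsSeparated at h2 ⊢
    omega
  notMem_iff u := by
    have hp := h.bounds p (by simp)
    have hne : u ≠ v ↔ c u ≠ c v := not_congr ⟨fun e => e ▸ rfl, hc.inj u v⟩
    rw [notMem_closedNbhdSet_insert, h.notMem_iff, hne, hc.adj_iff]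
    have hN := hmem (c u)
    have hL : ∀ q ∈ L, q.1 ≤ c u ∧ c u < q.1 + q.2 → c u + 1 < c v ∨ c v + 1 < c u := by
      intro q hq hu
      have := (List.pairwise_cons.1 h.pairwise).1 q hq
      unfold RunsSeparated at this
      omega
    have hLb : ∀ q ∈ L, q.1 ≤ c u ∧ c u < q.1 + q.2 → 2 ≤ c u ∧ c u + 1 < n := by
      intro q hq hu
      have := h.bounds q (by simp [hq])
      omega
    have happ : (∃ q ∈ N ++ L, q.1 ≤ c u ∧ c u < q.1 + q.2) ↔
        (∃ q ∈ N, q.1 ≤ c u ∧ c u < q.1 + q.2) ∨ ∃ q ∈ L, q.1 ≤ c u ∧ c u < q.1 + q.2 := by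
      simp only [List.mem_append, or_and_right, exists_or]
    rw [happ, hN, List.exists_mem_cons_iff]
    constructor
    · rintro ⟨hu | hu, huv⟩
      · left
        omega
      · exact Or.inr hu
    · rintro (hu | ⟨q, hq, hu⟩)
      · exact ⟨Or.inl hu.1, by omega⟩
      · have h1 := hL q hq hu
        have h2 := hLb q hq hu
        exact ⟨Or.inr ⟨q, hq, hu⟩, by omega⟩

lemma IsRunList.select_single {p q : ℕ × ℕ} {v : V}
    (h : IsRunList G n c X (p :: L)) (hc : IsCycleNumbering G n c)
    (hv : p.1 ≤ c v + 1 ∧ c v ≤ p.1 + p.2)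
    (hq : (q.1 = p.1 ∧ q.2 < p.2 ∧ q.1 + q.2 + 1 = c v ∧ p.1 + p.2 ≤ c v + 2) ∨
      (c v + 2 = q.1 ∧ q.1 + q.2 = p.1 + p.2 ∧ c v ≤ p.1)) :
    IsRunList G n c (insert v X) (q :: L) := by
  refine h.select (N := [q]) hc hv (by simp) ?_ fun j => ?_
  · simp only [List.mem_singleton, forall_eq]
    omega
  · simp only [List.mem_singleton, exists_eq_left]
    omega

lemma IsRunList.select_split {p : ℕ × ℕ} {v : V} {a b : ℕ}
    (h : IsRunList G n c X (p :: L)) (hc : IsCycleNumbering G n c)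
    (hv : p.1 + a + 1 = c v) (hab : p.2 = a + b + 3) :
    IsRunList G n c (insert v X) ((p.1, a) :: (c v + 2, b) :: L) := by
  refine h.select (N := [(p.1, a), (c v + 2, b)]) hc (by omega) ?_ ?_ fun j => ?_
  · simp [RunsSeparated]
    omega
  · simp
    omega
  · simp
    omega

/-- Every move lowers the weight by at least `1` and at most `15`. -/
lemma IsRunList.exists_of_isPlayable {v : V} (h : IsRunList G n c X L)
    (hc : IsCycleNumbering G n c) (hv : IsPlayable G X v) :
    ∃ M, IsRunList G n c (insert v X) M ∧ runListLength M < runListLength L ∧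
      runListWeight M + 1 ≤ runListWeight L ∧ runListWeight L ≤ runListWeight M + 15 := by
  obtain ⟨p, hp, hl, hpv⟩ := (h.isPlayable_iff hc v).1 hv
  obtain ⟨M, hLM, hM⟩ := h.exists_cons hp
  rw [runListLength_perm hLM, runListWeight_perm hLM]
  have h1 := runWeight_pred_bounds hl
  have h2 := runWeight_sub_two_bounds hl
  have hpb := h.bounds p hp
  by_cases ha : c v + 1 = p.1
  · refine ⟨_, hM.select_single (q := (p.1 + 1, p.2 - 1)) hc hpv (by simp only; omega), ?_, ?_, ?_⟩ <;>
      simp only [runListLength_cons, runListWeight_cons] <;> omega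
  by_cases hb : c v = p.1
  · refine ⟨_, hM.select_single (q := (p.1 + 2, p.2 - 2)) hc hpv (by simp only; omega), ?_, ?_, ?_⟩ <;>
      simp only [runListLength_cons, runListWeight_cons] <;> omega
  by_cases hd : c v = p.1 + p.2
  · refine ⟨_, hM.select_single (q := (p.1, p.2 - 1)) hc hpv (Or.inl (by simp only [true_and]; omega)), ?_, ?_, ?_⟩ <;>
      simp only [runListLength_cons, runListWeight_cons] <;> omega
  by_cases he : c v + 1 = p.1 + p.2
  · refine ⟨_, hM.select_single (q := (p.1, p.2 - 2)) hc hpv (Or.inl (by simp only [true_and]; omega)), ?_, ?_, ?_⟩ <;>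
      simp only [runListLength_cons, runListWeight_cons] <;> omega
  obtain ⟨a, ha'⟩ : ∃ a, p.1 + a + 1 = c v := ⟨c v - p.1 - 1, by omega⟩
  obtain ⟨b, hb'⟩ : ∃ b, p.2 = a + b + 3 := ⟨p.2 - a - 3, by omega⟩
  have h3 := runWeight_split_bounds a b
  rw [← hb'] at h3
  refine ⟨_, hM.select_split hc ha' hb', ?_, ?_, ?_⟩ <;>
    simp only [runListLength_cons, runListWeight_cons] <;> omega

lemma IsRunList.exists_dominator_move (h : IsRunList G n c X L)
    (hc : IsCycleNumbering G n c) (hL : ∃ p ∈ L, 2 ≤ p.2) :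
    ∃ v M, IsPlayable G X v ∧ IsRunList G n c (insert v X) M ∧
      runListLength M < runListLength L ∧
      runListWeight M + 8 + runListWeight L % 8 ≤ runListWeight L := by
  obtain ⟨p, hp, hl, hmod⟩ := exists_mod_le_runWeight_mod hL
  obtain ⟨M, hLM, hM⟩ := h.exists_cons hp
  have hpb := h.bounds p hp
  have hlen := runListLength_perm hLM
  have hwt := runListWeight_perm hLM
  rw [runListLength_cons] at hlen
  rw [runListWeight_cons] at hwt
  have h0 : runWeight 0 = 0 := rfl
  have h1 : runWeight 1 = 0 := rfl
  have hplay : ∀ v, p.1 ≤ c v + 1 → c v ≤ p.1 + p.2 → IsPlayable G X v :=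
    fun v hv₁ hv₂ => (h.isPlayable_iff hc v).2 ⟨p, hp, hl, hv₁, hv₂⟩
  by_cases h4 : 4 ≤ p.2
  · obtain ⟨v, hv⟩ := hc.surj (p.1 + 2) (by omega)
    have hw := runWeight_sub_four_le h4
    refine ⟨v, _, hplay v (by omega) (by omega),
      hM.select_split (a := 1) (b := p.2 - 4) hc (by omega) (by omega), ?_, ?_⟩
    · simp only [runListLength_cons]; omega
    · simp only [runListWeight_cons]; omega
  by_cases h3 : p.2 = 3
  · obtain ⟨v, hv⟩ := hc.surj (p.1 + 1) (by omega)
    have hw : runWeight p.2 = 12 := by rw [h3]; rfl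
    refine ⟨v, _, hplay v (by omega) (by omega),
      hM.select_split (a := 0) (b := 0) hc (by omega) (by omega), ?_, ?_⟩
    · simp only [runListLength_cons]; omega
    · simp only [runListWeight_cons]; omega
  · have h2 : p.2 = 2 := by omega
    obtain ⟨v, hv⟩ := hc.surj p.1 (by omega)
    have hw : runWeight p.2 = 8 := by rw [h2]; rfl
    refine ⟨v, _, hplay v (by omega) (by omega),
      hM.select_single (q := (p.1 + 2, 0)) hc (by omega) (by simp; omega), ?_, ?_⟩
    · simp only [runListLength_cons]; omega
    · simp only [runListWeight_cons]; omega

lemma IsRunList.exists_staller_move (h : IsRunList G n c X L)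
    (hc : IsCycleNumbering G n c) (hL : ∃ p ∈ L, 2 ≤ p.2) :
    ∃ v M, IsPlayable G X v ∧ IsRunList G n c (insert v X) M ∧
      runListLength M < runListLength L ∧
      (runListWeight L + 7) / 8 ≤ runListWeight M / 8 + 1 := by
  obtain ⟨p, hp, hl, hmod⟩ := exists_eight_le_mod_add_mod hL
  obtain ⟨M, hLM, hM⟩ := h.exists_cons hp
  have hpb := h.bounds p hp
  have hlen := runListLength_perm hLM
  have hwt := runListWeight_perm hLM
  rw [runListLength_cons] at hlen
  rw [runListWeight_cons] at hwt
  obtain ⟨v, hv⟩ := hc.surj (p.1 - 1) (by omega)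
  have hw := runWeight_le_pred hl
  refine ⟨v, _, (h.isPlayable_iff hc v).2 ⟨p, hp, hl, by omega, by omega⟩,
    hM.select_single (q := (p.1 + 1, p.2 - 1)) hc (by omega) (by simp; omega), ?_, ?_⟩
  · simp only [runListLength_cons]; omega
  · simp only [runListWeight_cons]; omega

/-- The value of a position is its weight divided by `8`, rounded down if Dominator is to move
and up if Staller is to move. -/
theorem IsRunList.isoGameVal_eq (hc : IsCycleNumbering G n c) (k : ℕ) (isDom : Bool)
    (h : IsRunList G n c X L) (hk : runListLength L ≤ k) :
    isoGameVal G k isDom X =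
      if isDom then runListWeight L / 8 else (runListWeight L + 7) / 8 := by
  induction k generalizing isDom X L with
  | zero =>
    have hw : runListWeight L = 0 := by
      by_contra hw
      obtain ⟨p, hp, hl⟩ := exists_two_le_of_runListWeight_ne_zero hw
      obtain ⟨M, hLM, -⟩ := h.exists_cons hp
      have := runListLength_perm hLM
      rw [runListLength_cons] at this
      omega
    simp [isoGameVal, hw]
  | succ k ih =>
    by_cases hplay : ∃ v, IsPlayable G X v
    · have hL : ∃ p ∈ L, 2 ≤ p.2 := by
        obtain ⟨v, hv⟩ := hplay
        obtain ⟨p, hp, hl, -⟩ := (h.isPlayable_iff hc v).1 hv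
        exact ⟨p, hp, hl⟩
      rw [isoGameVal, if_pos hplay]
      cases isDom with
      | true =>
        simp only [if_true, Bool.not_true]
        apply le_antisymm
        · obtain ⟨v, M, hv, hM, hlen, hw⟩ := h.exists_dominator_move hc hL
          refine le_trans (Nat.sInf_le ⟨v, hv, rfl⟩) ?_
          rw [ih false hM (by omega), if_neg Bool.false_ne_true]
          omega
        · refine le_csInf (hplay.elim fun v hv => ⟨_, v, hv, rfl⟩) ?_
          rintro _ ⟨v, hv, rfl⟩
          obtain ⟨M, hM, hlen, hw⟩ := h.exists_of_isPlayable hc hv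
          rw [ih false hM (by omega), if_neg Bool.false_ne_true]
          omega
      | false =>
        simp only [Bool.false_eq_true, if_false, Bool.not_false]
        have hub : (runListWeight L + 7) / 8 ∈ upperBounds
            {m | ∃ v, IsPlayable G X v ∧ m = isoGameVal G k true (insert v X) + 1} := by
          rintro _ ⟨v, hv, rfl⟩
          obtain ⟨M, hM, hlen, hw⟩ := h.exists_of_isPlayable hc hv
          rw [ih true hM (by omega), if_pos rfl]
          omega
        apply le_antisymm
        · exact csSup_le (hplay.elim fun v hv => ⟨_, v, hv, rfl⟩) hub
        · obtain ⟨v, M, hv, hM, hlen, hw⟩ := h.exists_staller_move hc hL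
          refine le_trans ?_ (le_csSup ⟨_, hub⟩ ⟨v, hv, rfl⟩)
          rw [ih true hM (by omega), if_pos rfl]
          exact hw
    · have hw : runListWeight L = 0 := by
        by_contra hw
        obtain ⟨v, -, hv, -⟩ :=
          h.exists_dominator_move hc (exists_two_le_of_runListWeight_ne_zero hw)
        exact hplay ⟨v, hv⟩
      rw [isoGameVal, if_neg hplay]
      simp [hw]

lemma isCycleNumbering_cycleGraph (m : ℕ) (v : Fin (m + 2)) :
    IsCycleNumbering (SimpleGraph.cycleGraph (m + 2)) (m + 2) fun u => (u - v).val where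
  lt u := (u - v).isLt
  inj u w h := sub_left_injective (Fin.val_injective h)
  surj i hi := ⟨⟨i, hi⟩ + v, by simp⟩
  adj_iff u w := by
    rw [SimpleGraph.cycleGraph_adj', ← sub_sub_sub_cancel_right u w v,
      ← sub_sub_sub_cancel_right w u v]
    generalize u - v = a
    generalize w - v = b
    have ha := a.isLt
    have hb := b.isLt
    rcases lt_trichotomy a b with h | h | h
    · rw [Fin.coe_sub_iff_lt.2 h, Fin.coe_sub_iff_le.2 h.le]
      have : a.val < b.val := h
      omega
    · subst h
      simp only [sub_self, Fin.val_zero]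
      omega
    · rw [Fin.coe_sub_iff_lt.2 h, Fin.coe_sub_iff_le.2 h.le]
      have : b.val < a.val := h
      omega

lemma IsCycleNumbering.isRunList_singleton (hc : IsCycleNumbering G n c) (hn : 4 ≤ n) {v : V}
    (hv : c v = 0) : IsRunList G n c (insert v ∅) [(2, n - 3)] where
  bounds := by
    simp
    omega
  pairwise := by simp
  notMem_iff u := by
    have hne : u ≠ v ↔ c u ≠ c v := not_congr ⟨fun e => e ▸ rfl, hc.inj u v⟩
    rw [notMem_closedNbhdSet_insert, hne, hc.adj_iff]
    have := hc.lt u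
    simp [closedNbhdSet]
    omega

/-- Theorem 1.3 (S-game part): for `n ≥ 4`, `ι_g'(C_n) = 2⌊n/5⌋ + 1` if `n ≡ 4 (mod 5)` and
`ι_g'(C_n) = 2⌊n/5⌋` otherwise.  (In ℕ, `⌊n/5⌋ = n / 5`.) -/
theorem stallerStart_game_isolation_number_cycle (n : ℕ) (hn : 4 ≤ n) :
    iotaGame' (SimpleGraph.cycleGraph n) =
      if n % 5 = 4 then 2 * (n / 5) + 1 else 2 * (n / 5) := by
  obtain ⟨m, rfl⟩ : ∃ m, n = m + 2 := ⟨n - 2, by omega⟩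
  set G := SimpleGraph.cycleGraph (m + 2)
  have hplay : ∀ v, IsPlayable G ∅ v := fun v => by
    obtain ⟨w, hw⟩ := (isCycleNumbering_cycleGraph m v).surj 1 (by omega)
    exact ⟨v, Or.inl rfl, by simp [closedNbhdSet], w,
      ((isCycleNumbering_cycleGraph m v).adj_iff v w).2 (by simp [hw]), by simp [closedNbhdSet]⟩
  have hval : ∀ v, isoGameVal G (m + 1) true (insert v ∅) = runWeight (m - 1) / 8 := fun v => by
    have hc := isCycleNumbering_cycleGraph m v
    have := (hc.isRunList_singleton hn (v := v) (by simp)).isoGameVal_eq hc (m + 1) true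
      (by simp; omega)
    simpa using this
  have hset : {k : ℕ | ∃ v, IsPlayable G ∅ v ∧
      k = isoGameVal G (m + 1) true (insert v ∅) + 1} = {runWeight (m - 1) / 8 + 1} := by
    ext k
    simp only [hplay, hval, true_and, Set.mem_ofPred_eq, Set.mem_singleton_iff, exists_const]
  rw [iotaGame', Fintype.card_fin, isoGameVal, if_pos ⟨0, hplay 0⟩]
  simp only [Bool.false_eq_true, if_false, Bool.not_false, hset, csSup_singleton]
  unfold runWeight
  split_ifs <;> omega
end

section
/- For every integer n ≥ 6, the game isolation number of the cycle satisfies the lower bound min{2·⌈n/5⌉, 2·⌈(n−4)/5⌉ + 1} ≤ ι_g(C_n). -/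
open SimpleGraph

variable {V : Type*}

/-- The edges `{i, i + 1}` of the cycle with no endpoint dominated by `X`, indexed by `i`. -/
def undominatedEdges (m : ℕ) (X : Set (Fin (m + 2))) : Set (Fin (m + 2)) :=
  {i | i ∉ closedNbhdSet (cycleGraph (m + 2)) X ∧ i + 1 ∉ closedNbhdSet (cycleGraph (m + 2)) X}

theorem closedNbhdSet_insert (G : SimpleGraph V) (X : Set V) (v : V) :
    closedNbhdSet G (insert v X) = {u | u = v ∨ G.Adj v u} ∪ closedNbhdSet G X := by
  ext u
  simp only [closedNbhdSet, Set.mem_insert_iff, Set.mem_union, Set.mem_ofPred_eq,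
    exists_eq_or_imp]
  tauto

theorem cycleGraph_adj_iff {m : ℕ} {u v : Fin (m + 2)} :
    (cycleGraph (m + 2)).Adj u v ↔ v = u - 1 ∨ v = u + 1 := by
  rw [cycleGraph_adj]
  constructor
  · rintro (h | h)
    · left; rw [← h]; abel
    · right; rw [← h]; abel
  · rintro (rfl | rfl)
    · left; abel
    · right; abel

theorem isPlayable_sub_one {m : ℕ} {X : Set (Fin (m + 2))} {i : Fin (m + 2)}
    (hi : i ∈ undominatedEdges m X) : IsPlayable (cycleGraph (m + 2)) X (i - 1) :=
  ⟨i, Or.inr (cycleGraph_adj_iff.2 (Or.inr (by abel))), hi.1, i + 1,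
    cycleGraph_adj_iff.2 (Or.inr rfl), hi.2⟩

theorem ncard_undominatedEdges_le_insert_add_four (m : ℕ) (X : Set (Fin (m + 2)))
    (v : Fin (m + 2)) :
    (undominatedEdges m X).ncard ≤ (undominatedEdges m (insert v X)).ncard + 4 := by
  have hsub : undominatedEdges m X ⊆
      undominatedEdges m (insert v X) ∪ {v - 1 - 1, v - 1, v, v + 1} := by
    rintro j ⟨h₀, h₁⟩
    by_contra hj
    simp only [undominatedEdges, closedNbhdSet_insert, Set.mem_union, Set.mem_ofPred_eq,
      cycleGraph_adj_iff, Set.mem_insert_iff, Set.mem_singleton_iff] at hj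
    have e₁ : j + 1 = v → j = v - 1 := fun h => by rw [← h]; abel
    have e₂ : j + 1 = v - 1 → j = v - 1 - 1 := fun h => by rw [← h]; abel
    have e₃ : j + 1 = v + 1 → j = v := fun h => add_right_cancel h
    tauto
  have hfour : ({v - 1 - 1, v - 1, v, v + 1} : Set (Fin (m + 2))).ncard ≤ 4 := by
    classical
    have := Finset.card_le_four (a := v - 1 - 1) (b := v - 1) (c := v) (d := v + 1)
    rw [← Set.ncard_coe_finset] at this
    simpa using this
  have h₁ := Set.ncard_le_ncard hsub (Set.toFinite _)
  have h₂ := Set.ncard_union_le (undominatedEdges m (insert v X)) {v - 1 - 1, v - 1, v, v + 1}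
  omega

open Fin.CommRing in
/-- Some undominated edge is preceded by a dominated vertex. -/
theorem exists_undominatedEdge_sub_one_mem {m : ℕ} {X : Set (Fin (m + 2))} (hX : X.Nonempty)
    (hE : (undominatedEdges m X).Nonempty) :
    ∃ i ∈ undominatedEdges m X, i - 1 ∈ closedNbhdSet (cycleGraph (m + 2)) X := by
  by_contra! h
  obtain ⟨x, hx⟩ := hX
  obtain ⟨i, hi⟩ := hE
  have key : ∀ k : ℕ, i - k • (1 : Fin (m + 2)) ∈ undominatedEdges m X := by
    intro k
    induction k with
    | zero => simpa using hi
    | succ k ih =>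
      have e : i - (k + 1) • (1 : Fin (m + 2)) = i - k • (1 : Fin (m + 2)) - 1 := by
        rw [succ_nsmul]; abel
      rw [e]
      exact ⟨h _ ih, by simpa using ih.1⟩
  have hk := key (i - x).val
  rw [nsmul_one, Fin.cast_val_eq_self, sub_sub_cancel] at hk
  exact hk.1 (Or.inl hx)

/-- On a cycle where some vertex has been selected, a move can be chosen that destroys only one
undominated edge. -/
theorem exists_isPlayable_ncard_le_insert_add_one {m : ℕ} {X : Set (Fin (m + 2))}
    (hX : X.Nonempty) (hE : (undominatedEdges m X).Nonempty) :
    ∃ v, IsPlayable (cycleGraph (m + 2)) X v ∧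
      (undominatedEdges m X).ncard ≤ (undominatedEdges m (insert v X)).ncard + 1 := by
  obtain ⟨i, hi, hd⟩ := exists_undominatedEdge_sub_one_mem hX hE
  refine ⟨i - 1, isPlayable_sub_one hi, ?_⟩
  have hd' : i - 1 - 1 ∈ closedNbhdSet (cycleGraph (m + 2)) X := by
    rcases hd with hd | ⟨x, hx, hadj⟩
    · exact absurd (Or.inr ⟨_, hd, cycleGraph_adj_iff.2 (Or.inr (by abel))⟩) hi.1
    · rcases cycleGraph_adj_iff.1 hadj.symm with rfl | rfl
      · exact Or.inl hx
      · exact absurd (Or.inl (by simpa using hx)) hi.1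
  have hsub : undominatedEdges m X ⊆ insert i (undominatedEdges m (insert (i - 1) X)) := by
    rintro j ⟨h₀, h₁⟩
    by_contra hj
    simp only [undominatedEdges, closedNbhdSet_insert, Set.mem_union, Set.mem_ofPred_eq,
      cycleGraph_adj_iff, Set.mem_insert_iff, sub_add_cancel] at hj
    have a₁ : j ≠ i - 1 := by rintro rfl; exact h₀ hd
    have a₂ : j ≠ i - 1 - 1 := by rintro rfl; exact h₀ hd'
    have b₁ : j + 1 ≠ i - 1 := fun h => h₁ (h ▸ hd)
    have b₂ : j + 1 ≠ i - 1 - 1 := fun h => h₁ (h ▸ hd')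
    have b₃ : j + 1 ≠ i := fun h => a₁ (by rw [← h]; abel)
    tauto
  exact (Set.ncard_le_ncard hsub (Set.toFinite _)).trans (Set.ncard_insert_le _ _)

theorem isoGameVal_le (G : SimpleGraph V) (k : ℕ) (b : Bool) (X : Set V) :
    isoGameVal G k b X ≤ k := by
  induction k generalizing b X with
  | zero => simp [isoGameVal]
  | succ k ih =>
    rw [isoGameVal]
    split_ifs with h hb
    · obtain ⟨v, hv⟩ := h
      refine le_trans (Nat.sInf_le (m := isoGameVal G k (!b) (insert v X) + 1) ⟨v, hv, rfl⟩) ?_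
      have := ih (!b) (insert v X)
      omega
    · obtain ⟨v, hv⟩ := h
      refine csSup_le ⟨_, v, hv, rfl⟩ ?_
      rintro _ ⟨w, -, rfl⟩
      have := ih (!b) (insert w X)
      omega
    · omega

theorem le_isoGameVal_true {G : SimpleGraph V} {k c : ℕ} {X : Set V}
    (hex : ∃ v, IsPlayable G X v)
    (h : ∀ v, c ≤ isoGameVal G k false (insert v X) + 1) :
    c ≤ isoGameVal G (k + 1) true X := by
  rw [isoGameVal, if_pos hex, if_pos rfl]
  obtain ⟨v, hv⟩ := hex
  refine le_csInf ⟨_, v, hv, rfl⟩ ?_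
  rintro _ ⟨w, -, rfl⟩
  exact h w

theorem le_isoGameVal_false {G : SimpleGraph V} {k c : ℕ} {X : Set V} {v : V}
    (hv : IsPlayable G X v) (h : c ≤ isoGameVal G k true (insert v X) + 1) :
    c ≤ isoGameVal G (k + 1) false X := by
  have hex : ∃ v, IsPlayable G X v := ⟨v, hv⟩
  rw [isoGameVal, if_pos hex, if_neg Bool.false_ne_true]
  refine h.trans (le_csSup ⟨k + 1, ?_⟩ ⟨v, hv, rfl⟩)
  rintro _ ⟨w, -, rfl⟩
  exact Nat.succ_le_succ (isoGameVal_le _ _ _ _)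

/-- With `w` undominated edges left, Staller guarantees about two moves for every five edges:
Dominator destroys at most four edges per move, and Staller only one. -/
theorem le_isoGameVal_cycleGraph {m : ℕ} (k w : ℕ) (X : Set (Fin (m + 2)))
    (hw : w ≤ (undominatedEdges m X).ncard) (hk : w ≤ k) :
    (X.Nonempty → 2 * (w / 5) + min 2 (w % 5) ≤
        isoGameVal (cycleGraph (m + 2)) k false X) ∧
      2 * ((w + 1) / 5) + min 2 ((w + 1) % 5) ≤
        isoGameVal (cycleGraph (m + 2)) k true X + 1 := by
  induction k generalizing w X with
  | zero =>
    obtain rfl : w = 0 := by omega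
    simp
  | succ k ih =>
    rcases Nat.eq_zero_or_pos w with rfl | hpos
    · simp
    have hE : (undominatedEdges m X).Nonempty :=
      (Set.ncard_pos (Set.toFinite _)).1 (by omega)
    constructor
    · intro hX
      obtain ⟨v, hv, hcard⟩ := exists_isPlayable_ncard_le_insert_add_one hX hE
      refine le_isoGameVal_false hv ?_
      have := (ih (w - 1) (insert v X) (by omega) (by omega)).2
      rwa [Nat.sub_add_cancel hpos] at this
    · obtain ⟨i, hi⟩ := hE
      rw [← Nat.sub_le_iff_le_add]
      refine le_isoGameVal_true ⟨_, isPlayable_sub_one hi⟩ fun v => ?_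
      have hcard := ncard_undominatedEdges_le_insert_add_four m X v
      have := (ih (w - 4) (insert v X) (by omega) (by omega)).1 (Set.insert_nonempty v X)
      omega

/-- Claim A, inequality (1): for `n ≥ 6`,
`min {2⌈n/5⌉, 2⌈(n-4)/5⌉ + 1} ≤ ι_g(C_n)`.
(In ℕ, `⌈m/5⌉ = (m + 4) / 5`.) -/
theorem cycle_game_isolation_lower_bound (n : ℕ) (hn : 6 ≤ n) :
    min (2 * ((n + 4) / 5)) (2 * ((n - 4 + 4) / 5) + 1) ≤
      iotaGame (SimpleGraph.cycleGraph n) := by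
  obtain ⟨m, rfl⟩ : ∃ m, n = m + 2 := ⟨n - 2, by omega⟩
  have hcard : (undominatedEdges m ∅).ncard = m + 2 := by
    simp [undominatedEdges, closedNbhdSet, Set.ncard_univ]
  have := (le_isoGameVal_cycleGraph (m + 2) (m + 2) ∅ hcard.ge le_rfl).2
  rw [iotaGame, Fintype.card_fin]
  omega
end

section
/- For every integer n ≥ 6: if n ≢ 4 (mod 5) then ι_g'(C_n) ≤ 2·⌊n/5⌋, and if n ≡ 4 (mod 5) then ι_g'(C_n) ≤ 2·⌊n/5⌋ + 1. -/
open SimpleGraph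

variable {V : Type*}

theorem closedNbhdSet_mono {V : Type*} (G : SimpleGraph V) {X Y : Set V} (h : X ⊆ Y) :
    closedNbhdSet G X ⊆ closedNbhdSet G Y := by
  rintro u (hu | ⟨x, hx, hxu⟩)
  · exact Or.inl (h hu)
  · exact Or.inr ⟨x, h hx, hxu⟩

theorem IsPlayable.of_insert {V : Type*} {G : SimpleGraph V} {X : Set V} {v w : V}
    (h : IsPlayable G (insert v X) w) : IsPlayable G X w := by
  have hX := closedNbhdSet_mono G (Set.subset_insert v X)
  obtain ⟨u, huw, hu, z, huz, hz⟩ := h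
  exact ⟨u, huw, fun hu' => hu (hX hu'), z, huz, fun hz' => hz (hX hz')⟩

theorem not_isPlayable_insert_self {V : Type*} (G : SimpleGraph V) (X : Set V) (v : V) :
    ¬ IsPlayable G (insert v X) v := by
  rintro ⟨u, rfl | hvu, hu, -⟩
  · exact hu (Or.inl (Set.mem_insert u X))
  · exact hu (Or.inr ⟨v, Set.mem_insert v X, hvu⟩)

theorem ncard_isPlayable_insert_add_one_le {V : Type*} [Finite V] {G : SimpleGraph V}
    {X : Set V} {v : V} (hv : IsPlayable G X v) :
    {w | IsPlayable G (insert v X) w}.ncard + 1 ≤ {w | IsPlayable G X w}.ncard := by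
  refine Set.ncard_lt_ncard ⟨fun w hw => IsPlayable.of_insert hw, fun h => ?_⟩
  exact not_isPlayable_insert_self G X v (h hv)

/-- If every playable position has at least four playable vertices, and Dominator can always
destroy at least four of them once some vertex has been selected, then every round (one move of
each player) destroys at least five, which bounds the length of the game. -/
theorem isoGameVal_le_of_ncard_isPlayable {V : Type*} [Finite V] {G : SimpleGraph V}
    (hcard : ∀ X : Set V, (∃ v, IsPlayable G X v) → 4 ≤ {w | IsPlayable G X w}.ncard)
    (hdom : ∀ X : Set V, X.Nonempty → (∃ v, IsPlayable G X v) → ∃ v, IsPlayable G X v ∧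
      {w | IsPlayable G (insert v X) w}.ncard + 4 ≤ {w | IsPlayable G X w}.ncard)
    (k : ℕ) (X : Set V) :
    isoGameVal G k false X ≤
        {w | IsPlayable G X w}.ncard / 5 + ({w | IsPlayable G X w}.ncard + 1) / 5 ∧
      (X.Nonempty → isoGameVal G k true X ≤
        ({w | IsPlayable G X w}.ncard + 1) / 5 + ({w | IsPlayable G X w}.ncard + 2) / 5 - 1) := by
  induction k generalizing X with
  | zero => simp [isoGameVal]
  | succ k ih =>
    by_cases hX : ∃ v, IsPlayable G X v
    · constructor
      · rw [isoGameVal, if_pos hX]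
        simp only [Bool.false_eq_true, if_false, Bool.not_false]
        obtain ⟨v₀, hv₀⟩ := hX
        refine csSup_le ⟨_, v₀, hv₀, rfl⟩ ?_
        rintro _ ⟨v, hv, rfl⟩
        have hlt := ncard_isPlayable_insert_add_one_le hv
        have hval := (ih (insert v X)).2 (Set.insert_nonempty v X)
        have hfour := hcard X ⟨v, hv⟩
        omega
      · intro hne
        rw [isoGameVal, if_pos hX]
        simp only [if_true, Bool.not_true]
        obtain ⟨v, hv, hle⟩ := hdom X hne hX
        have hval := (ih (insert v X)).1
        have hinf : sInf {n | ∃ v, IsPlayable G X v ∧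
            n = isoGameVal G k false (insert v X) + 1} ≤
            isoGameVal G k false (insert v X) + 1 := Nat.sInf_le ⟨v, hv, rfl⟩
        omega
    · simp [isoGameVal, hX]

theorem mem_closedNbhdSet_cycleGraph {m : ℕ} {X : Set (Fin (m + 2))} {u : Fin (m + 2)} :
    u ∈ closedNbhdSet (cycleGraph (m + 2)) X ↔ u ∈ X ∨ u - 1 ∈ X ∨ u + 1 ∈ X := by
  simp only [closedNbhdSet, Set.mem_ofPred_eq]
  refine or_congr_right ⟨?_, ?_⟩
  · rintro ⟨x, hx, h⟩
    rcases cycleGraph_adj.1 h with h | h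
    · exact Or.inr (by rwa [← h, add_sub_cancel])
    · exact Or.inl (by rwa [← h, sub_sub_cancel])
  · rintro (h | h)
    · exact ⟨_, h, cycleGraph_adj.2 (Or.inr (sub_sub_cancel _ _))⟩
    · exact ⟨_, h, cycleGraph_adj.2 (Or.inl (add_sub_cancel_left _ _))⟩

theorem isPlayable_cycleGraph_iff {m : ℕ} {X : Set (Fin (m + 2))} {v : Fin (m + 2)} :
    IsPlayable (cycleGraph (m + 2)) X v ↔
      ∃ y, y ∉ closedNbhdSet (cycleGraph (m + 2)) X ∧
        y + 1 ∉ closedNbhdSet (cycleGraph (m + 2)) X ∧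
        (v = y - 1 ∨ v = y ∨ v = y + 1 ∨ v = y + 1 + 1) := by
  constructor
  · rintro ⟨u, huv, hu, w, huw, hw⟩
    rw [cycleGraph_adj] at huw huv
    rcases huw with h | h
    · obtain rfl : w + 1 = u := by rw [← h, add_sub_cancel]
      refine ⟨w, hw, hu, ?_⟩
      rcases huv with h | h | h
      · exact Or.inr (Or.inr (Or.inl h.symm))
      · exact Or.inr (Or.inr (Or.inr (sub_eq_iff_eq_add'.1 h)))
      · refine Or.inr (Or.inl ?_)
        rw [sub_eq_iff_eq_add, add_comm 1 v] at h
        exact (add_right_cancel h).symm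
    · obtain rfl : u + 1 = w := by rw [← h, add_sub_cancel]
      refine ⟨u, hu, hw, ?_⟩
      rcases huv with h | h | h
      · exact Or.inr (Or.inl h.symm)
      · exact Or.inr (Or.inr (Or.inl (by rw [← h]; abel)))
      · exact Or.inl (by rw [← h]; abel)
  · rintro ⟨y, hy, hy', h⟩
    have hadj : (cycleGraph (m + 2)).Adj y (y + 1) :=
      cycleGraph_adj.2 (Or.inr (add_sub_cancel_left _ _))
    rcases h with rfl | rfl | rfl | rfl
    · exact ⟨y, Or.inr (cycleGraph_adj.2 (Or.inr (sub_sub_cancel _ _))), hy, _, hadj, hy'⟩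
    · exact ⟨v, Or.inl rfl, hy, _, hadj, hy'⟩
    · exact ⟨_, Or.inl rfl, hy', _, hadj.symm, hy⟩
    · exact ⟨_, Or.inr (cycleGraph_adj.2 (Or.inl (add_sub_cancel_left _ _))), hy', _,
        hadj.symm, hy⟩

theorem ncard_four_consecutive {m : ℕ} (hm : 2 ≤ m) (y : Fin (m + 2)) :
    ({y - 1, y, y + 1, y + 1 + 1} : Set (Fin (m + 2))).ncard = 4 := by
  obtain ⟨m, rfl⟩ := Nat.exists_eq_add_of_le' hm
  have hne (z c : Fin (m + 2 + 2)) (hc : c ≠ 0) : z ≠ z + c := by simpa using hc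
  have h1 : (1 : Fin (m + 2 + 2)) ≠ 0 := by simp
  have h2 : (1 + 1 : Fin (m + 2 + 2)) ≠ 0 := by
    simp [Fin.ext_iff, Fin.val_add, Nat.mod_eq_of_lt (show 2 < m + 2 + 2 by omega)]
  have h3 : (1 + 1 + 1 : Fin (m + 2 + 2)) ≠ 0 := by
    simp [Fin.ext_iff, Fin.val_add, Nat.mod_eq_of_lt (show 3 < m + 2 + 2 by omega)]
  obtain ⟨z, rfl⟩ : ∃ z, y = z + 1 := ⟨y - 1, (sub_add_cancel y 1).symm⟩
  have hz1 := fun z => hne z _ h1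
  have hz2 := fun z => hne z _ h2
  have hz3 := hne z _ h3
  simp only [← add_assoc] at hz2 hz3
  rw [add_sub_cancel_right, Set.ncard_insert_of_notMem, Set.ncard_insert_of_notMem,
    Set.ncard_pair (hz1 _)]
  · simp only [Set.mem_insert_iff, Set.mem_singleton_iff, not_or]
    exact ⟨hz1 _, hz2 _⟩
  · simp only [Set.mem_insert_iff, Set.mem_singleton_iff, not_or]
    exact ⟨hz1 _, hz2 _, hz3⟩

theorem four_le_ncard_isPlayable_cycleGraph {m : ℕ} (hm : 2 ≤ m) (X : Set (Fin (m + 2)))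
    (h : ∃ v, IsPlayable (cycleGraph (m + 2)) X v) :
    4 ≤ {w | IsPlayable (cycleGraph (m + 2)) X w}.ncard := by
  obtain ⟨v, hv⟩ := h
  obtain ⟨y, hy, hy', -⟩ := isPlayable_cycleGraph_iff.1 hv
  rw [← ncard_four_consecutive hm y]
  refine Set.ncard_le_ncard fun w hw => isPlayable_cycleGraph_iff.2 ⟨y, hy, hy', ?_⟩
  simpa using hw

/-- A nontrivial run of undominated vertices has a first vertex, once the dominated set is
nonempty. -/
theorem exists_first_undominated_cycleGraph {m : ℕ} {X : Set (Fin (m + 2))} (hX : X.Nonempty)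
    (h : ∃ v, IsPlayable (cycleGraph (m + 2)) X v) :
    ∃ y, y - 1 ∈ closedNbhdSet (cycleGraph (m + 2)) X ∧
      y ∉ closedNbhdSet (cycleGraph (m + 2)) X ∧
      y + 1 ∉ closedNbhdSet (cycleGraph (m + 2)) X := by
  by_contra! hno
  obtain ⟨v, hv⟩ := h
  obtain ⟨y, hy, hy', -⟩ := isPlayable_cycleGraph_iff.1 hv
  have hback : ∀ k : ℕ, y - k • 1 ∉ closedNbhdSet (cycleGraph (m + 2)) X ∧
      y - k • 1 + 1 ∉ closedNbhdSet (cycleGraph (m + 2)) X := by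
    intro k
    induction k with
    | zero => simpa using ⟨hy, hy'⟩
    | succ k ih =>
      have hsub : y - (k + 1) • 1 = y - k • 1 - 1 := by rw [succ_nsmul, sub_sub]
      rw [hsub, sub_add_cancel]
      exact ⟨fun hmem => ih.2 (hno _ hmem ih.1), ih.1⟩
  obtain ⟨x, hx⟩ := hX
  have hcast : (y - x).val • (1 : Fin (m + 2)) = y - x := by
    open scoped Fin.CommRing in
    rw [nsmul_one, Fin.cast_val_eq_self]
  have := (hback (y - x).val).1
  rw [hcast, sub_sub_cancel] at this
  exact this (Or.inl hx)

theorem exists_isPlayable_cycleGraph_ncard_add_four_le {m : ℕ} (hm : 2 ≤ m)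
    (X : Set (Fin (m + 2))) (hX : X.Nonempty)
    (h : ∃ v, IsPlayable (cycleGraph (m + 2)) X v) :
    ∃ v, IsPlayable (cycleGraph (m + 2)) X v ∧
      {w | IsPlayable (cycleGraph (m + 2)) (insert v X) w}.ncard + 4 ≤
        {w | IsPlayable (cycleGraph (m + 2)) X w}.ncard := by
  obtain ⟨y, hprev, hy, hy'⟩ := exists_first_undominated_cycleGraph hX h
  have hplay : ∀ w ∈ ({y - 1, y, y + 1, y + 1 + 1} : Set (Fin (m + 2))),
      IsPlayable (cycleGraph (m + 2)) X w := fun w hw =>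
    isPlayable_cycleGraph_iff.2 ⟨y, hy, hy', by simpa using hw⟩
  refine ⟨y + 1 + 1, hplay _ (by simp), ?_⟩
  rw [← ncard_four_consecutive hm y, ← Set.ncard_union_eq]
  · refine Set.ncard_le_ncard ?_
    rintro w (hw | hw)
    · exact IsPlayable.of_insert hw
    · exact hplay w hw
  rw [Set.disjoint_right]
  intro w hw hw'
  obtain ⟨z, hz, hz', hwz⟩ := isPlayable_cycleGraph_iff.1 hw'
  have hX' := closedNbhdSet_mono (cycleGraph (m + 2)) (Set.subset_insert (y + 1 + 1) X)
  have hdom : ∀ c, c = y + 1 ∨ c = y + 1 + 1 ∨ c = y + 1 + 1 + 1 ∨ c = y - 1 ∨ c = y - 1 - 1 →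
      c ∈ closedNbhdSet (cycleGraph (m + 2)) (insert (y + 1 + 1) X) := by
    rintro c (rfl | rfl | rfl | rfl | rfl)
    · exact mem_closedNbhdSet_cycleGraph.2 (Or.inr (Or.inr (Set.mem_insert _ _)))
    · exact Or.inl (Set.mem_insert _ _)
    · exact mem_closedNbhdSet_cycleGraph.2 (Or.inr (Or.inl (by simp)))
    · exact hX' hprev
    · refine hX' (mem_closedNbhdSet_cycleGraph.2 ?_)
      rw [mem_closedNbhdSet_cycleGraph] at hprev hy
      rw [sub_add_cancel] at hprev ⊢
      tauto
  have hzD := mt (hdom z) hz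
  have hzD' := mt (hdom (z + 1)) hz'
  simp only [Set.mem_insert_iff, Set.mem_singleton_iff] at hw
  grind

/-- Claim B(b): for `n ≥ 6`, if `n ≢ 4 (mod 5)` then `ι_g'(C_n) ≤ 2⌊n/5⌋`, and if
`n ≡ 4 (mod 5)` then `ι_g'(C_n) ≤ 2⌊n/5⌋ + 1`.  (In ℕ, `⌊n/5⌋ = n / 5`.) -/
theorem cycle_stallerStart_game_isolation_upper_bound (n : ℕ) (hn : 6 ≤ n) :
    (n % 5 ≠ 4 → iotaGame' (SimpleGraph.cycleGraph n) ≤ 2 * (n / 5)) ∧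
    (n % 5 = 4 → iotaGame' (SimpleGraph.cycleGraph n) ≤ 2 * (n / 5) + 1) := by
  obtain ⟨m, rfl⟩ := Nat.exists_eq_add_of_le' (show 2 ≤ n by omega)
  have hm : 2 ≤ m := by omega
  have hval := (isoGameVal_le_of_ncard_isPlayable (four_le_ncard_isPlayable_cycleGraph hm)
    (exists_isPlayable_cycleGraph_ncard_add_four_le hm) (Fintype.card (Fin (m + 2))) ∅).1
  have hle : {w | IsPlayable (cycleGraph (m + 2)) ∅ w}.ncard ≤ m + 2 := by
    simpa using Set.ncard_le_card {w | IsPlayable (cycleGraph (m + 2)) ∅ w}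
  rw [← iotaGame'] at hval
  constructor <;> intro <;> omega
end
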